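/- For every natural number n ≥ 1, the (n+2)-nd prime is at most the sum of the (n+1)-st and n-th primes: Nat.nth Nat.Prime (n+1) ≤ Nat.nth Nat.Prime n + Nat.nth Nat.Prime (n-1). (Equivalently, there is no n such that p₍ₙ₊₁₎ > pₙ + p₍ₙ₋₁₎.) -/

import Mathlib

theorem centralBinom_le_aux (n p0 : ℕ) (hn : 2 < n)
    (H : ∀ r : ℕ, r.Prime → n < r → r ≤ 2 * n → r = p0) :
    Nat.centralBinom n ≤ (2 * n) ^ Nat.sqrt (2 * n) * 4 ^ (2 * n / 3) := by
  classical
  have hs : 1 ≤ Nat.sqrt (2 * n) := Nat.sqrt_pos.2 (by omega)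
  let S := {p ∈ Finset.range (2 * n + 1) | Nat.Prime p}
  let f : ℕ → ℕ := fun x => x ^ n.centralBinom.factorization x
  have h1 : ∏ x ∈ S, f x = Nat.centralBinom n := by
    rw [← n.prod_pow_factorization_centralBinom]
    refine Finset.prod_filter_of_ne fun p _ h => ?_
    contrapose h
    simp only [f]
    rw [Nat.factorization_eq_zero_of_not_prime n.centralBinom h, pow_zero]
  rw [← h1, ← Finset.prod_filter_mul_prod_filter_not S (fun p => p ≤ Nat.sqrt (2 * n) ∨ p = p0)]
  apply mul_le_mul'
  · refine (Finset.prod_le_prod' fun p _ => (?_ : f p ≤ 2 * n)).trans ?_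
    · exact Nat.pow_factorization_choose_le (by omega)
    rw [Finset.prod_const]
    refine Nat.pow_le_pow_right (by omega) ?_
    have hsub : {p ∈ S | p ≤ Nat.sqrt (2 * n) ∨ p = p0} ⊆
        insert p0 (Finset.Icc 2 (Nat.sqrt (2 * n))) := by
      intro x hx
      obtain ⟨h1, h2⟩ := Finset.mem_filter.1 hx
      have := (Finset.mem_filter.1 h1).2.two_le
      rw [Finset.mem_insert, Finset.mem_Icc]
      tauto
    have h3 := (Finset.card_le_card hsub).trans (Finset.card_insert_le _ _)
    rw [Nat.card_Icc] at h3
    omega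
  · refine le_trans ?_ (primorial_le_four_pow (2 * n / 3))
    have h2 : ∀ p ∈ {p ∈ S | ¬ (p ≤ Nat.sqrt (2 * n) ∨ p = p0)}, f p ≠ 1 → p ≤ 2 * n / 3 := by
      intro p hp h
      obtain ⟨h1, h2⟩ := Finset.mem_filter.1 hp
      obtain ⟨h3, h4⟩ := Finset.mem_filter.1 h1
      have h5 := Finset.mem_range.1 h3
      by_contra hc
      apply h
      have h6 : p ≤ n := by
        by_contra h7
        exact h2 (Or.inr (H p h4 (by omega) (by omega)))
      simp only [f]
      rw [Nat.factorization_centralBinom_of_two_mul_self_lt_three_mul hn h6 (by omega), pow_zero]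
    rw [← Finset.prod_filter_of_ne h2]
    refine (Finset.prod_le_prod' fun p hp => (?_ : f p ≤ p)).trans ?_
    · obtain ⟨h1, h2⟩ := Finset.mem_filter.1 (Finset.mem_filter.1 hp).1
      refine (Nat.pow_le_pow_right (Finset.mem_filter.1 h1).2.pos ?_).trans (pow_one p).le
      exact Nat.factorization_choose_le_one (Nat.sqrt_lt'.mp (by omega))
    · refine Finset.prod_le_prod_of_subset_of_one_le' ?_ ?_
      · intro p hp
        obtain ⟨h3, h4⟩ := Finset.mem_filter.1 hp
        obtain ⟨h1, h2⟩ := Finset.mem_filter.1 (Finset.mem_filter.1 h3).1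
        exact Finset.mem_filter.2 ⟨Finset.mem_range.2 (by omega), h2⟩
      · exact fun p hp _ => (Finset.mem_filter.1 hp).2.one_lt.le

theorem two_primes_aux (n : ℕ) (hn : 6 ≤ n) :
    ∃ p r : ℕ, p.Prime ∧ r.Prime ∧ n < p ∧ p < r ∧ r ≤ 2 * n := by
  rcases lt_or_ge n 512 with h | h
  · have key : ∀ a b c : ℕ, b.Prime → c.Prime → b < c → c ≤ 2 * a → a ≤ n → n < b →
        ∃ p r : ℕ, p.Prime ∧ r.Prime ∧ n < p ∧ p < r ∧ r ≤ 2 * n :=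
      fun a b c hb hc h1 h2 h3 h4 => ⟨b, c, hb, hc, h4, h1, by omega⟩
    rcases lt_or_ge n 7 with h0 | h0
    · exact key 6 7 11 (by norm_num) (by norm_num) (by norm_num) (by norm_num) hn h0
    rcases lt_or_ge n 11 with h1 | h1
    · exact key 7 11 13 (by norm_num) (by norm_num) (by norm_num) (by norm_num) h0 h1
    rcases lt_or_ge n 13 with h2 | h2
    · exact key 11 13 19 (by norm_num) (by norm_num) (by norm_num) (by norm_num) h1 h2
    rcases lt_or_ge n 19 with h3 | h3
    · exact key 13 19 23 (by norm_num) (by norm_num) (by norm_num) (by norm_num) h2 h3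
    rcases lt_or_ge n 23 with h4 | h4
    · exact key 19 23 37 (by norm_num) (by norm_num) (by norm_num) (by norm_num) h3 h4
    rcases lt_or_ge n 37 with h5 | h5
    · exact key 23 37 43 (by norm_num) (by norm_num) (by norm_num) (by norm_num) h4 h5
    rcases lt_or_ge n 43 with h6 | h6
    · exact key 37 43 73 (by norm_num) (by norm_num) (by norm_num) (by norm_num) h5 h6
    rcases lt_or_ge n 73 with h7 | h7
    · exact key 43 73 83 (by norm_num) (by norm_num) (by norm_num) (by norm_num) h6 h7
    rcases lt_or_ge n 83 with h8 | h8
    · exact key 73 83 139 (by norm_num) (by norm_num) (by norm_num) (by norm_num) h7 h8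
    rcases lt_or_ge n 139 with h9 | h9
    · exact key 83 139 163 (by norm_num) (by norm_num) (by norm_num) (by norm_num) h8 h9
    rcases lt_or_ge n 163 with h10 | h10
    · exact key 139 163 277 (by norm_num) (by norm_num) (by norm_num) (by norm_num) h9 h10
    rcases lt_or_ge n 277 with h11 | h11
    · exact key 163 277 317 (by norm_num) (by norm_num) (by norm_num) (by norm_num) h10 h11
    rcases lt_or_ge n 317 with h12 | h12
    · exact key 277 317 547 (by norm_num) (by norm_num) (by norm_num) (by norm_num) h11 h12
    exact key 317 547 631 (by norm_num) (by norm_num) (by norm_num) (by norm_num) h12 (by omega)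
  · obtain ⟨p0, hp0, h1, h2⟩ := Nat.exists_prime_lt_and_le_two_mul n (by omega)
    by_contra hc
    push Not at hc
    have H : ∀ r : ℕ, r.Prime → n < r → r ≤ 2 * n → r = p0 := by
      intro r hr h3 h4
      rcases lt_trichotomy r p0 with h5 | h5 | h5
      · have := hc r p0 hr hp0 h3 h5
        omega
      · exact h5
      · have := hc p0 r hp0 hr h1 h5
        omega
    have a := centralBinom_le_aux n p0 (by omega) H
    have b := Nat.four_pow_lt_mul_centralBinom n (by omega)
    have c := bertrand_main_inequality h
    have d := Nat.mul_le_mul_left n a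
    rw [← mul_assoc] at d
    omega

/-- for `n ≥ 1`, `p_{n+1} ≤ p_n + p_{n-1}`, where
`p_m = Nat.nth Nat.Prime m` is the `(m+1)`-st prime. -/
theorem nth_prime_succ_le_add (n : ℕ) (hn : 1 ≤ n) :
    Nat.nth Nat.Prime (n + 1) ≤ Nat.nth Nat.Prime n + Nat.nth Nat.Prime (n - 1) := by
  obtain ⟨m, rfl⟩ : ∃ m, n = m + 1 := ⟨n - 1, by omega⟩
  rw [Nat.add_sub_cancel]
  have inf := Nat.infinite_setOfPred_prime
  have next : ∀ k r : ℕ, r.Prime → Nat.nth Nat.Prime k < r → Nat.nth Nat.Prime (k + 1) ≤ r := by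
    intro k r hr h
    have h3 : Nat.count Nat.Prime (Nat.nth Nat.Prime k + 1) ≤ Nat.count Nat.Prime r :=
      Nat.count_monotone _ h
    rw [Nat.count_nth_succ_of_infinite inf] at h3
    have h4 := Nat.nth_monotone inf h3
    rwa [Nat.nth_count hr] at h4
  have hq := Nat.prime_nth_prime m
  have hlt : Nat.nth Nat.Prime m < Nat.nth Nat.Prime (m + 1) := Nat.nth_strictMono inf (by omega)
  have n1 := next m
  have n2 := next (m + 1)
  generalize Nat.nth Nat.Prime m = q at *
  generalize Nat.nth Nat.Prime (m + 1) = p at *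
  rcases lt_or_ge q 6 with h | h
  · have := hq.two_le
    have a3 := n1 3 (by norm_num)
    have a5 := n1 5 (by norm_num)
    have a7 := n1 7 (by norm_num)
    have b5 := n2 5 (by norm_num)
    have b7 := n2 7 (by norm_num)
    have b11 := n2 11 (by norm_num)
    interval_cases q <;> omega
  · obtain ⟨a, b, ha, hb, h1, h2, h3⟩ := two_primes_aux q h
    have := n1 a ha h1
    have := n2 b hb (by omega)
    omega
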